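/- arXiv:0903.2593 — 2 statements merged into one kernel-verified Lean document; each statement's English description precedes it below -/
import Mathlib

section
/- Let f : X → Y be an MR-map. Then the posets RC(X) and RC(Y) of regular closed subsets of X and of Y are order-isomorphic (equivalently, the Boolean algebras RC(X) and RC(Y) are isomorphic); in fact F ↦ cl(f(F)) is such an isomorphism. If, moreover, X and Y are π-semiregular spaces, then πw(X) = πw(Y). -/
/-- `f^♯(U) = {y | f⁻¹(y) ⊆ U}`. -/
def fSharp {X Y : Type*} (f : X → Y) (U : Set X) : Set Y :=
  {y : Y | f ⁻¹' {y} ⊆ U}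

/-- A π-base of a topological space: a family of open sets such that every nonempty open
set contains a nonempty member of the family. -/
def IsPiBase {X : Type*} [TopologicalSpace X] (B : Set (Set X)) : Prop :=
  (∀ U ∈ B, IsOpen U) ∧ ∀ V : Set X, IsOpen V → V ≠ ∅ → ∃ U ∈ B, U ≠ ∅ ∧ U ⊆ V

/-- The π-weight of a topological space: the minimum cardinality of a π-base. -/
noncomputable def piWeight (X : Type*) [TopologicalSpace X] : Cardinal :=
  ⨅ B : {B : Set (Set X) // IsPiBase B}, Cardinal.mk ↥B.1

open Set

/-- The set of all open sets is a π-base. -/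
theorem isPiBase_isOpen (X : Type*) [TopologicalSpace X] :
    IsPiBase {U : Set X | IsOpen U} :=
  ⟨fun _ h => h, fun V hV hne => ⟨V, hV, hne, Subset.rfl⟩⟩

/-- If some map carries every π-base of `Y` to a π-base of `X`, then `πw(X) ≤ πw(Y)`. -/
theorem piWeight_le_of_image {X Y : Type u} [TopologicalSpace X] [TopologicalSpace Y]
    (g : Set Y → Set X) (hg : ∀ B : Set (Set Y), IsPiBase B → IsPiBase (g '' B)) :
    piWeight X ≤ piWeight Y := by
  have : Nonempty {B : Set (Set Y) // IsPiBase B} := ⟨⟨_, isPiBase_isOpen Y⟩⟩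
  refine le_ciInf fun B => ?_
  exact (ciInf_le' (fun B : {B : Set (Set X) // IsPiBase B} => Cardinal.mk ↥B.1)
    ⟨g '' B.1, hg B.1 B.2⟩).trans Cardinal.mk_image_le

/-- The preimage of the interior of `f^♯(U)` is contained in `U`. -/
theorem preimage_interior_fSharp_subset {X Y : Type*} [TopologicalSpace Y]
    (f : X → Y) (U : Set X) : f ⁻¹' interior (fSharp f U) ⊆ U :=
  fun _ hx => interior_subset hx rfl

theorem fSharp_mono {X Y : Type*} (f : X → Y) {U V : Set X} (h : U ⊆ V) :
    fSharp f U ⊆ fSharp f V :=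
  fun _ hy => Subset.trans hy h

theorem closure_image_preimage_of_isOpen {X Y : Type*} [TopologicalSpace Y]
    {f : X → Y} (hd : Dense (range f)) {W : Set Y} (hW : IsOpen W) :
    closure (f '' (f ⁻¹' W)) = closure W := by
  rw [image_preimage_eq_inter_range]
  exact Subset.antisymm (closure_mono inter_subset_left)
    (closure_minimal (hd.open_subset_closure_inter hW) isClosed_closure)

theorem nonempty_preimage_of_isOpen {X Y : Type*} [TopologicalSpace Y]
    {f : X → Y} (hd : Dense (range f)) {W : Set Y} (hW : IsOpen W) (hne : W.Nonempty) :
    (f ⁻¹' W).Nonempty := by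
  obtain ⟨_, hy, x, rfl⟩ := hd.inter_open_nonempty W hW hne
  exact ⟨x, hy⟩

section MRMap

variable {X Y : Type*} [TopologicalSpace X] [TopologicalSpace Y] {f : X → Y}

theorem nonempty_interior_fSharp_of_isOpen
    (hmr : ∀ U : Set X, U = interior (closure U) → U ≠ ∅ → interior (fSharp f U) ≠ ∅)
    {V : Set X} (hV : IsOpen V) (hne : V.Nonempty) :
    (interior (fSharp f (interior (closure V)))).Nonempty := by
  refine nonempty_iff_ne_empty.2 (hmr _ interior_closure_idem.symm ?_)
  exact (hne.mono hV.subset_interior_closure).ne_empty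

/-- The preimage of a nonempty open subset of `int(f^♯(int(cl V)))` meets `V`. -/
theorem inter_preimage_nonempty (hf : Continuous f) (hd : Dense (range f))
    {V : Set X} {W : Set Y} (hW : IsOpen W) (hne : W.Nonempty)
    (hsub : W ⊆ interior (fSharp f (interior (closure V)))) :
    (V ∩ f ⁻¹' W).Nonempty := by
  obtain ⟨z, hz⟩ := nonempty_preimage_of_isOpen hd hW hne
  have hzV : z ∈ closure V :=
    interior_subset (preimage_interior_fSharp_subset f _ (hsub hz))
  rw [inter_comm]
  exact mem_closure_iff.1 hzV _ (hW.preimage hf) hz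

/-- An MR-map satisfies `F = cl(f⁻¹(int(f^♯(int F))))` for regular closed `F`. -/
theorem closure_preimage_interior_fSharp (hf : Continuous f) (hd : Dense (range f))
    (hmr : ∀ U : Set X, U = interior (closure U) → U ≠ ∅ → interior (fSharp f U) ≠ ∅)
    {F : Set X} (hF : F = closure (interior F)) :
    closure (f ⁻¹' interior (fSharp f (interior F))) = F := by
  have hFc : IsClosed F := hF ▸ isClosed_closure
  refine Subset.antisymm (closure_minimal
    ((preimage_interior_fSharp_subset f _).trans interior_subset) hFc) ?_
  conv_lhs => rw [hF]
  refine closure_minimal (fun x hx => ?_) isClosed_closure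
  by_contra hxW
  set V := interior F \ closure (f ⁻¹' interior (fSharp f (interior F)))
  have hV : IsOpen V := isOpen_interior.sdiff isClosed_closure
  have hsub : interior (closure V) ⊆ interior F :=
    interior_mono (closure_minimal (sdiff_subset.trans interior_subset) hFc)
  obtain ⟨z, hzV, hz⟩ := inter_preimage_nonempty hf hd isOpen_interior
    (nonempty_interior_fSharp_of_isOpen hmr hV ⟨x, hx, hxW⟩) Subset.rfl
  exact hzV.2 (subset_closure (interior_mono (fSharp_mono f hsub) hz))

theorem preimage_subset_of_subset_closure (hf : Continuous f) (hd : Dense (range f))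
    (hmr : ∀ U : Set X, U = interior (closure U) → U ≠ ∅ → interior (fSharp f U) ≠ ∅)
    {W₁ W₂ : Set Y} (h₁ : IsOpen W₁) (h₂ : IsOpen W₂) (h : W₁ ⊆ closure W₂) :
    f ⁻¹' W₁ ⊆ closure (f ⁻¹' W₂) := by
  intro x hx
  by_contra hxW
  set V := f ⁻¹' W₁ \ closure (f ⁻¹' W₂)
  have hV : IsOpen V := (h₁.preimage hf).sdiff isClosed_closure
  obtain ⟨z, hzV, hz⟩ := inter_preimage_nonempty hf hd isOpen_interior
    (nonempty_interior_fSharp_of_isOpen hmr hV ⟨x, hx, hxW⟩) Subset.rfl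
  have hne := mem_closure_iff.1 (h hzV.1) _ isOpen_interior hz
  obtain ⟨t, htV, ht⟩ := inter_preimage_nonempty hf hd (isOpen_interior.inter h₂) hne
    inter_subset_left
  exact htV.2 (subset_closure ht.2)

theorem closure_image_eq_closure_interior_fSharp (hf : Continuous f) (hd : Dense (range f))
    (hmr : ∀ U : Set X, U = interior (closure U) → U ≠ ∅ → interior (fSharp f U) ≠ ∅)
    {F : Set X} (hF : F = closure (interior F)) :
    closure (f '' F) = closure (interior (fSharp f (interior F))) := by
  conv_lhs => rw [← closure_preimage_interior_fSharp hf hd hmr hF,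
    closure_image_closure hf, closure_image_preimage_of_isOpen hd isOpen_interior]

theorem closure_eq_closure_interior_closure {Z : Type*} [TopologicalSpace Z] {U : Set Z}
    (hU : IsOpen U) : closure U = closure (interior (closure U)) :=
  Subset.antisymm (closure_mono hU.subset_interior_closure)
    (closure_minimal interior_subset isClosed_closure)

/-- Preimages under an MR-map carry π-bases to π-bases of a π-semiregular domain. -/
theorem IsPiBase.image_preimage (hf : Continuous f) (hd : Dense (range f))
    (hmr : ∀ U : Set X, U = interior (closure U) → U ≠ ∅ → interior (fSharp f U) ≠ ∅)
    (hX : IsPiBase {U : Set X | U = interior (closure U)})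
    {B : Set (Set Y)} (hB : IsPiBase B) : IsPiBase (preimage f '' B) := by
  refine ⟨?_, fun V hV hne => ?_⟩
  · rintro _ ⟨U, hU, rfl⟩
    exact (hB.1 U hU).preimage hf
  · obtain ⟨U, hU, hUne, hUV⟩ := hX.2 V hV hne
    obtain ⟨W, hWB, hWne, hWU⟩ := hB.2 _ isOpen_interior (hmr U hU hUne)
    exact ⟨_, ⟨W, hWB, rfl⟩,
      (nonempty_preimage_of_isOpen hd (hB.1 W hWB) (nonempty_iff_ne_empty.2 hWne)).ne_empty,
      (preimage_mono hWU).trans ((preimage_interior_fSharp_subset f U).trans hUV)⟩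

/-- For an MR-map, `U ↦ int(f^♯(int(cl U)))` carries π-bases to π-bases of a π-semiregular
codomain. -/
theorem IsPiBase.image_interior_fSharp (hf : Continuous f) (hd : Dense (range f))
    (hmr : ∀ U : Set X, U = interior (closure U) → U ≠ ∅ → interior (fSharp f U) ≠ ∅)
    (hY : IsPiBase {V : Set Y | V = interior (closure V)})
    {B : Set (Set X)} (hB : IsPiBase B) :
    IsPiBase ((fun U => interior (fSharp f (interior (closure U)))) '' B) := by
  refine ⟨?_, fun V hV hne => ?_⟩
  · rintro _ ⟨U, _, rfl⟩
    exact isOpen_interior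
  · obtain ⟨V', hV', hVne, hVV⟩ := hY.2 V hV hne
    have hVo : IsOpen V' := hY.1 V' hV'
    obtain ⟨U, hUB, hUne, hUV⟩ := hB.2 _ (hVo.preimage hf)
      (nonempty_preimage_of_isOpen hd hVo (nonempty_iff_ne_empty.2 hVne)).ne_empty
    refine ⟨_, ⟨U, hUB, rfl⟩, (nonempty_interior_fSharp_of_isOpen hmr (hB.1 U hUB)
      (nonempty_iff_ne_empty.2 hUne)).ne_empty, Subset.trans ?_ hVV⟩
    change interior (fSharp f (interior (closure U))) ⊆ V'
    rw [show V' = interior (closure V') from hV']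
    refine interior_maximal ?_ isOpen_interior
    refine subset_closure.trans ?_
    rw [← closure_image_preimage_of_isOpen hd isOpen_interior,
      ← closure_image_preimage_of_isOpen hd hVo, ← closure_image_closure hf (s := f ⁻¹' V')]
    exact closure_mono (image_mono ((preimage_interior_fSharp_subset f _).trans
      (interior_subset.trans (closure_mono hUV))))

end MRMap

/-- If `f : X → Y` is an MR-map, then `F ↦ cl(f(F))` is an order isomorphism between the
posets `RC(X)` and `RC(Y)` of regular closed sets; if moreover `X` and `Y` are
π-semiregular, then `πw(X) = πw(Y)`. -/
theorem stmt11 {X Y : Type u} [TopologicalSpace X] [TopologicalSpace Y]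
    (f : X → Y) (hf : Continuous f) (hd : Dense (Set.range f))
    (hmr : ∀ U : Set X, U = interior (closure U) → U ≠ ∅ → interior (fSharp f U) ≠ ∅) :
    (∃ e : {F : Set X // F = closure (interior F)} ≃o
        {G : Set Y // G = closure (interior G)},
      ∀ F : {F : Set X // F = closure (interior F)}, (e F).1 = closure (f '' F.1)) ∧
    (IsPiBase {U : Set X | U = interior (closure U)} →
      IsPiBase {V : Set Y | V = interior (closure V)} →
      piWeight X = piWeight Y) := by
  refine ⟨?_, fun hX hY => le_antisymm
    (piWeight_le_of_image _ fun _ hB => IsPiBase.image_preimage hf hd hmr hX hB)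
    (piWeight_le_of_image _ fun _ hB => IsPiBase.image_interior_fSharp hf hd hmr hY hB)⟩
  have hRC : ∀ F : {F : Set X // F = closure (interior F)},
      closure (f '' F.1) = closure (interior (closure (f '' F.1))) := fun F => by
    rw [closure_image_eq_closure_interior_fSharp hf hd hmr F.2]
    exact closure_eq_closure_interior_closure isOpen_interior
  let φ : {F : Set X // F = closure (interior F)} ↪o {G : Set Y // G = closure (interior G)} :=
    OrderEmbedding.ofMapLEIff (fun F => ⟨closure (f '' F.1), hRC F⟩) fun F₁ F₂ => by
      refine ⟨fun h => ?_, fun h => closure_mono (image_mono h)⟩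
      change closure (f '' F₁.1) ⊆ closure (f '' F₂.1) at h
      rw [closure_image_eq_closure_interior_fSharp hf hd hmr F₁.2,
        closure_image_eq_closure_interior_fSharp hf hd hmr F₂.2] at h
      change F₁.1 ⊆ F₂.1
      rw [← closure_preimage_interior_fSharp hf hd hmr F₁.2,
        ← closure_preimage_interior_fSharp hf hd hmr F₂.2]
      exact closure_minimal (preimage_subset_of_subset_closure hf hd hmr isOpen_interior
        isOpen_interior (subset_closure.trans h)) isClosed_closure
  refine ⟨RelIso.ofSurjective φ fun G => ?_, fun F => rfl⟩
  refine ⟨⟨closure (f ⁻¹' interior G.1),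
    closure_eq_closure_interior_closure (isOpen_interior.preimage hf)⟩, Subtype.ext ?_⟩
  change closure (f '' closure (f ⁻¹' interior G.1)) = G.1
  rw [closure_image_closure hf, closure_image_preimage_of_isOpen hd isOpen_interior]
  exact G.2.symm
end

section
/- Let X be a compact Hausdorff space and τ an infinite cardinal. If πw(X) = τ, then there exists a compact Hausdorff zero-dimensional space Y with w(Y) = τ such that X and Y are co-absolute. -/
universe u

/-- The weight of a topological space: the minimum cardinality of a base of open sets. -/
noncomputable def tweight (X : Type*) [TopologicalSpace X] : Cardinal :=
  ⨅ B : {B : Set (Set X) // TopologicalSpace.IsTopologicalBasis B}, Cardinal.mk ↥B.1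

/-- `g` is a continuous irreducible map of `(E, tE)` onto `(Z, tZ)`:
continuous, surjective, and no proper closed subset maps onto `Z`. -/
def IrreducibleOnto {E Z : Type*} (tE : TopologicalSpace E) (tZ : TopologicalSpace Z)
    (g : E → Z) : Prop :=
  @Continuous E Z tE tZ g ∧ Function.Surjective g ∧
    ∀ A : Set E, @IsClosed E tE A → A ≠ Set.univ → g '' A ≠ Set.univ

/-- `X` and `Y` are co-absolute: there is an extremally disconnected compact Hausdorff
space `E` and irreducible continuous maps from `E` onto `X` and onto `Y`. -/
def CoAbsolute (X Y : Type u) (tX : TopologicalSpace X) (tY : TopologicalSpace Y) : Prop :=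
  ∃ (E : Type u) (tE : TopologicalSpace E),
    @CompactSpace E tE ∧ @T2Space E tE ∧ @ExtremallyDisconnected E tE ∧
    (∃ g : E → X, IrreducibleOnto tE tX g) ∧ ∃ h : E → Y, IrreducibleOnto tE tY h

open Set Function TopologicalSpace

section ProjectiveCover

/-- A continuous self-map commuting with an irreducible map is the identity. -/
theorem IrreducibleOnto.eq_id_of_comp_eq {E Z : Type*} [tE : TopologicalSpace E] [T2Space E]
    [tZ : TopologicalSpace Z] {g : E → Z} (hg : IrreducibleOnto tE tZ g) {e : E → E}
    (he : Continuous e) (hge : g ∘ e = g) : e = id := by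
  by_contra hne
  obtain ⟨x, hx⟩ := Function.ne_iff.1 hne
  obtain ⟨V, W, hV, hW, hxV, hxW, hVW⟩ := t2_separation hx
  have hU : IsOpen (e ⁻¹' V ∩ W) := (hV.preimage he).inter hW
  refine hg.2.2 (e ⁻¹' V ∩ W)ᶜ hU.isClosed_compl ?_ (eq_univ_of_forall fun z => ?_)
  · exact fun h => (h ▸ mem_univ x : x ∈ (e ⁻¹' V ∩ W)ᶜ) ⟨hxV, hxW⟩
  · obtain ⟨y, rfl⟩ := hg.2.1 z
    by_cases hy : y ∈ e ⁻¹' V ∩ W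
    · exact ⟨e y, fun h => disjoint_left.1 hVW hy.1 h.2, congr_fun hge y⟩
    · exact ⟨y, hy, rfl⟩

theorem CompactT2.Projective.of_retract {P E : Type u} [TopologicalSpace P] [TopologicalSpace E]
    (hP : CompactT2.Projective P) {i : E → P} {r : P → E} (hi : Continuous i) (hr : Continuous r)
    (hri : r ∘ i = id) : CompactT2.Projective E := by
  intro Y Z _ _ _ _ _ _ f g hf hg hsurj
  obtain ⟨h, hh, hgh⟩ := hP (hf.comp hr) hg hsurj
  refine ⟨h ∘ i, hh.comp hi, ?_⟩
  rw [← comp_assoc, hgh, comp_assoc, hri, comp_id]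

/-- A compact Hausdorff quotient of a projective compact Hausdorff space has an
extremally disconnected irreducible preimage. -/
theorem exists_irreducibleOnto_of_projective {P X : Type u} [TopologicalSpace P] [CompactSpace P]
    [T2Space P] [tX : TopologicalSpace X] [CompactSpace X] [T2Space X]
    (hP : CompactT2.Projective P) {p : P → X} (hp : Continuous p) (hsurj : Surjective p) :
    ∃ (E : Type u) (tE : TopologicalSpace E), CompactSpace E ∧ T2Space E ∧
      ExtremallyDisconnected E ∧ ∃ g : E → X, IrreducibleOnto tE tX g := by
  obtain ⟨E, hE, himg, hmin⟩ := exists_compact_surjective_zorn_subset hp hsurj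
  have hg : IrreducibleOnto (inferInstance : TopologicalSpace E) tX (fun x : E => p x) := by
    refine ⟨hp.comp continuous_subtype_val, fun z => ?_, fun A hA hne => hmin A hne hA⟩
    obtain ⟨x, hx, rfl⟩ := himg.symm ▸ mem_univ z
    exact ⟨⟨x, hx⟩, rfl⟩
  refine ⟨E, inferInstance, hE, inferInstance, ?_, _, hg⟩
  obtain ⟨r, hr, hgr⟩ := hP hp hg.1 hg.2.1
  have hid : r ∘ ((↑) : E → P) = id :=
    hg.eq_id_of_comp_eq (hr.comp continuous_subtype_val) (by rw [← comp_assoc, hgr]; rfl)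
  exact CompactT2.Projective.extremallyDisconnected
    (CompactT2.Projective.of_retract hP continuous_subtype_val hr hid)

theorem exists_irreducibleOnto_of_discreteTopology {D X : Type u} [TopologicalSpace D]
    [DiscreteTopology D] [tX : TopologicalSpace X] [CompactSpace X] [T2Space X] {f : D → X}
    (hf : Surjective f) :
    ∃ (E : Type u) (tE : TopologicalSpace E), CompactSpace E ∧ T2Space E ∧
      ExtremallyDisconnected E ∧ ∃ g : E → X, IrreducibleOnto tE tX g := by
  have hc : Continuous f := continuous_of_discreteTopology
  refine exists_irreducibleOnto_of_projective (StoneCech.projective (X := D))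
    (continuous_stoneCechExtend hc) fun x => ?_
  obtain ⟨d, rfl⟩ := hf x
  exact ⟨stoneCechUnit d, congr_fun (stoneCechExtend_extends hc) d⟩

/-- Every compact Hausdorff space has an extremally disconnected irreducible preimage. -/
theorem exists_extremallyDisconnected_irreducibleOnto (X : Type u) [tX : TopologicalSpace X]
    [CompactSpace X] [T2Space X] :
    ∃ (E : Type u) (tE : TopologicalSpace E), CompactSpace E ∧ T2Space E ∧
      ExtremallyDisconnected E ∧ ∃ g : E → X, IrreducibleOnto tE tX g := by
  obtain ⟨D, tD, hD, f, hf⟩ : ∃ (D : Type u) (tD : TopologicalSpace D),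
      DiscreteTopology D ∧ ∃ f : D → X, Surjective f := ⟨X, ⊥, discreteTopology_bot X, id, surjective_id⟩
  exact exists_irreducibleOnto_of_discreteTopology hf

end ProjectiveCover

section PiBase

theorem IrreducibleOnto.isOpen_kernImage {E Z : Type*} [tE : TopologicalSpace E] [CompactSpace E]
    [tZ : TopologicalSpace Z] [T2Space Z] {g : E → Z} (hg : IrreducibleOnto tE tZ g) {V : Set E}
    (hV : IsOpen V) : IsOpen (kernImage g V) :=
  isClosedMap_iff_kernImage.1 hg.1.isClosedMap hV

theorem IrreducibleOnto.kernImage_nonempty {E Z : Type*} [tE : TopologicalSpace E]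
    [tZ : TopologicalSpace Z] {g : E → Z} (hg : IrreducibleOnto tE tZ g) {V : Set E}
    (hV : IsOpen V) (hne : V.Nonempty) : (kernImage g V).Nonempty := by
  rw [kernImage_eq_compl, nonempty_compl]
  refine hg.2.2 _ hV.isClosed_compl fun h => ?_
  rw [compl_univ_iff] at h
  exact hne.ne_empty h

/-- Every nonempty open set contains a nonempty preimage of a member of the π-base. -/
theorem IrreducibleOnto.exists_preimage_subset {E Z : Type*} [tE : TopologicalSpace E]
    [CompactSpace E] [tZ : TopologicalSpace Z] [T2Space Z] {g : E → Z}
    (hg : IrreducibleOnto tE tZ g) {B : Set (Set Z)} (hB : IsPiBase B) {V : Set E}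
    (hV : IsOpen V) (hne : V.Nonempty) : ∃ U ∈ B, (g ⁻¹' U).Nonempty ∧ g ⁻¹' U ⊆ V := by
  obtain ⟨U, hU, hUne, hUV⟩ :=
    hB.2 _ (hg.isOpen_kernImage hV) (hg.kernImage_nonempty hV hne).ne_empty
  exact ⟨U, hU, (nonempty_iff_ne_empty.2 hUne).preimage hg.2.1, subset_kernImage_iff.1 hUV⟩

theorem TopologicalSpace.IsTopologicalBasis.isPiBase {Y : Type*} [TopologicalSpace Y]
    {B : Set (Set Y)} (hB : IsTopologicalBasis B) : IsPiBase B := by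
  refine ⟨fun U => hB.isOpen, fun V hV hne => ?_⟩
  obtain ⟨y, hy⟩ := nonempty_iff_ne_empty.2 hne
  obtain ⟨U, hU, hyU, hUV⟩ := hB.exists_subset_of_mem_open hy hV
  exact ⟨U, hU, nonempty_iff_ne_empty.1 ⟨y, hyU⟩, hUV⟩

theorem piWeight_le_mk {X : Type u} [TopologicalSpace X] {B : Set (Set X)} (hB : IsPiBase B) :
    piWeight X ≤ Cardinal.mk B :=
  ciInf_le' (fun B : {B : Set (Set X) // IsPiBase B} => Cardinal.mk ↥B.1) ⟨B, hB⟩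

theorem tweight_le_mk {X : Type u} [TopologicalSpace X] {B : Set (Set X)}
    (hB : IsTopologicalBasis B) : tweight X ≤ Cardinal.mk B :=
  ciInf_le' (fun B : {B : Set (Set X) // IsTopologicalBasis B} => Cardinal.mk ↥B.1) ⟨B, hB⟩

theorem exists_isPiBase_mk_eq (X : Type u) [TopologicalSpace X] :
    ∃ B : Set (Set X), IsPiBase B ∧ Cardinal.mk B = piWeight X := by
  have : Nonempty {B : Set (Set X) // IsPiBase B} := ⟨⟨_, isTopologicalBasis_opens.isPiBase⟩⟩
  obtain ⟨B, hB⟩ := ciInf_mem fun B : {B : Set (Set X) // IsPiBase B} => Cardinal.mk ↥B.1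
  exact ⟨B.1, B.2, hB⟩

theorem exists_isTopologicalBasis_mk_eq (X : Type u) [TopologicalSpace X] :
    ∃ B : Set (Set X), IsTopologicalBasis B ∧ Cardinal.mk B = tweight X := by
  have : Nonempty {B : Set (Set X) // IsTopologicalBasis B} := ⟨⟨_, isTopologicalBasis_opens⟩⟩
  obtain ⟨B, hB⟩ :=
    ciInf_mem fun B : {B : Set (Set X) // IsTopologicalBasis B} => Cardinal.mk ↥B.1
  exact ⟨B.1, B.2, hB⟩

theorem piWeight_le_tweight (X : Type u) [TopologicalSpace X] : piWeight X ≤ tweight X := by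
  obtain ⟨B, hB, hcard⟩ := exists_isTopologicalBasis_mk_eq X
  exact hcard ▸ piWeight_le_mk hB.isPiBase

/-- π-weight does not grow from `Y` to `X` when both are irreducible images of one compact space. -/
theorem piWeight_le_of_irreducibleOnto {E X Y : Type u} [tE : TopologicalSpace E] [CompactSpace E]
    [tX : TopologicalSpace X] [T2Space X] [tY : TopologicalSpace Y] [T2Space Y]
    {g : E → X} {h : E → Y} (hg : IrreducibleOnto tE tX g) (hh : IrreducibleOnto tE tY h) :
    piWeight X ≤ piWeight Y := by
  obtain ⟨B, hB, hcard⟩ := exists_isPiBase_mk_eq Y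
  have hpi : IsPiBase ((fun V => kernImage g (h ⁻¹' V)) '' B) := by
    refine ⟨?_, fun W hW hne => ?_⟩
    · rintro _ ⟨V, hV, rfl⟩
      exact hg.isOpen_kernImage ((hB.1 V hV).preimage hh.1)
    · obtain ⟨V, hV, hVne, hVW⟩ := hh.exists_preimage_subset hB (hW.preimage hg.1)
        ((nonempty_iff_ne_empty.2 hne).preimage hg.2.1)
      refine ⟨_, ⟨V, hV, rfl⟩,
        (hg.kernImage_nonempty ((hB.1 V hV).preimage hh.1) hVne).ne_empty, fun x hx => ?_⟩
      obtain ⟨e, rfl⟩ := hg.2.1 x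
      exact hVW (hx rfl)
  exact hcard ▸ (piWeight_le_mk hpi).trans Cardinal.mk_image_le

end PiBase

section CantorCube

/-- A subspace of the Cantor cube `I → Bool` has weight at most `#I`. -/
theorem tweight_subtype_cantorCube_le {I : Type u} [Infinite I] (Y : Set (I → Bool)) :
    tweight Y ≤ Cardinal.mk I := by
  let N : Finset (I × Bool) → Set (I → Bool) := fun F => {y | ∀ p ∈ F, y p.1 = p.2}
  have hN : IsTopologicalBasis (range N) := by
    refine isTopologicalBasis_of_isOpen_of_nhds ?_ fun y U hy hU => ?_
    · rintro _ ⟨F, rfl⟩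
      have : N F = ⋂ p ∈ F, (fun y : I → Bool => y p.1) ⁻¹' {p.2} := by
        ext; simp [N]
      rw [this]
      exact isOpen_biInter_finset fun p _ =>
        (isOpen_discrete _).preimage (continuous_apply p.1)
    · classical
      obtain ⟨F, u, hu, hsub⟩ := isOpen_pi_iff.1 hU y hy
      refine ⟨_, ⟨F.image fun i => (i, y i), rfl⟩, by simp [N], fun z hz => hsub fun i hi => ?_⟩
      have : z i = y i := hz (i, y i) (Finset.mem_image_of_mem _ hi)
      exact this ▸ (hu i hi).2
  calc tweight Y ≤ Cardinal.mk (preimage ((↑) : Y → I → Bool) '' range N) :=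
        tweight_le_mk (hN.induced _)
    _ ≤ Cardinal.mk (range N) := Cardinal.mk_image_le
    _ ≤ Cardinal.mk (Finset (I × Bool)) := Cardinal.mk_range_le
    _ = Cardinal.mk I := by
      rw [Cardinal.mk_finset_of_infinite, Cardinal.mk_prod, Cardinal.lift_uzero]
      exact Cardinal.mul_eq_left (Cardinal.aleph0_le_mk I)
        (by simpa using (Cardinal.natCast_lt_aleph0 (n := 2)).le.trans (Cardinal.aleph0_le_mk I))
        (by simp)

/-- A family of clopen sets that is dense among the open sets of a compact space yields an
irreducible map onto a closed subspace of a Cantor cube. -/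
theorem exists_irreducibleOnto_cantorCube {E I : Type*} [tE : TopologicalSpace E] [CompactSpace E]
    (C : I → Set E) (hC : ∀ i, IsClopen (C i))
    (hdense : ∀ V : Set E, IsOpen V → V.Nonempty → ∃ i, (C i).Nonempty ∧ C i ⊆ V) :
    ∃ (Y : Set (I → Bool)) (h : E → Y), IsClosed Y ∧ IrreducibleOnto tE inferInstance h := by
  classical
  let f : E → I → Bool := fun e i => decide (e ∈ C i)
  have hf : Continuous f := continuous_pi fun i =>
    (continuous_bool_rng true).2 (by simpa [f, preimage] using hC i)
  refine ⟨range f, rangeFactorization f, (isCompact_range hf).isClosed, hf.subtype_mk _,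
    rangeFactorization_surjective, fun A hA hne himg => ?_⟩
  obtain ⟨i, ⟨e, he⟩, hi⟩ := hdense Aᶜ hA.isOpen_compl (nonempty_compl.2 hne)
  obtain ⟨a, ha, hae⟩ := himg.symm ▸ mem_univ (rangeFactorization f e)
  have hfi : f a i = f e i := congr_fun (congr_arg Subtype.val hae) i
  have : a ∈ C i := by simpa [f, he] using hfi
  exact hi this ha

end CantorCube

/-- A compact Hausdorff space of infinite π-weight `τ` is co-absolute with a compact
Hausdorff zero-dimensional space of weight `τ`. -/
theorem stmt16 {X : Type u} [tX : TopologicalSpace X] [CompactSpace X] [T2Space X]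
    (τ : Cardinal.{u}) (hτ : Cardinal.aleph0 ≤ τ) (hpw : piWeight X = τ) :
    ∃ (Y : Type u) (tY : TopologicalSpace Y),
      @CompactSpace Y tY ∧ @T2Space Y tY ∧
      @TopologicalSpace.IsTopologicalBasis Y tY {s : Set Y | @IsClopen Y tY s} ∧
      @tweight Y tY = τ ∧ CoAbsolute X Y tX tY := by
  obtain ⟨E, tE, hE, hT2, hED, g, hg⟩ := exists_extremallyDisconnected_irreducibleOnto X
  obtain ⟨B, hB, hcard⟩ := exists_isPiBase_mk_eq X
  rw [hpw] at hcard
  have : Infinite B := Cardinal.infinite_iff.2 (hcard ▸ hτ)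
  obtain ⟨Y, h, hY, hh⟩ := exists_irreducibleOnto_cantorCube
    (fun U : B => closure (g ⁻¹' (U : Set X)))
    (fun U => ⟨isClosed_closure, hED.open_closure _ ((hB.1 U U.2).preimage hg.1)⟩) (by
      rintro V hV ⟨x, hx⟩
      obtain ⟨W, hW, hWc, hWV⟩ := exists_mem_nhds_isClosed_subset (hV.mem_nhds hx)
      obtain ⟨U, hU, hne, hsub⟩ := hg.exists_preimage_subset hB isOpen_interior
        ⟨x, mem_interior_iff_mem_nhds.2 hW⟩
      exact ⟨⟨U, hU⟩, hne.closure,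
        (closure_minimal (hsub.trans interior_subset) hWc).trans hWV⟩)
  have : CompactSpace Y := isCompact_iff_compactSpace.1 hY.isCompact
  refine ⟨Y, inferInstance, this, inferInstance, loc_compact_Haus_tot_disc_of_zero_dim,
    le_antisymm ?_ ?_, E, tE, hE, hT2, hED, ⟨g, hg⟩, h, hh⟩
  · exact (tweight_subtype_cantorCube_le Y).trans_eq hcard
  · exact hpw ▸ (piWeight_le_of_irreducibleOnto hg hh).trans (piWeight_le_tweight Y)
end
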